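/- Suppose d > 0, n ∈ [2,3], and c ∈ [1.55, n). Then for each i = 1, 2, 3, the function μᵢ(Q) tends to 0 as Q → 1⁻, and μᵢ(Q) < 0 for all Q sufficiently close to 1 with Q < 1. -/

import Mathlib

open Set Filter Topology intervalIntegral Real

noncomputable section

/-- The rescaled traveling-wave ODE for the magma equation at a point `r`. -/
def magmaODE (d n c : ℝ) (Q : ℝ → ℝ) (r : ℝ) : Prop :=
  -deriv Q r + (1 / c) * deriv (fun s => Q s ^ n) r
    + deriv (fun s => Q s ^ n * deriv (deriv Q) s) r
    + (d - 1) * Q r ^ n * deriv (fun s => deriv Q s / s) r = 0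

/-- Solution of the IVP on `[0, σ]`. -/
def isIVPSolutionOn (d n c μ : ℝ) (Q : ℝ → ℝ) (σ : ℝ) : Prop :=
  ContDiffOn ℝ 3 Q (Icc 0 σ) ∧ (∀ r ∈ Ioo (0:ℝ) σ, magmaODE d n c Q r) ∧
    Q 0 = 1 ∧ deriv Q 0 = 0 ∧ deriv (deriv Q) 0 = μ

/-- Solution of the IVP on `[0, ∞)`. -/
def isIVPSolution (d n c μ : ℝ) (Q : ℝ → ℝ) : Prop :=
  ContDiffOn ℝ 3 Q (Ici 0) ∧ (∀ r : ℝ, 0 < r → magmaODE d n c Q r) ∧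
    Q 0 = 1 ∧ deriv Q 0 = 0 ∧ deriv (deriv Q) 0 = μ

def F1 (d n c : ℝ) (Q μ : ℝ) : ℝ :=
  -(1 / (n - 1)) * (Q ^ (1 - n) - 1) - (n / c) * Real.log Q + μ * d

def F2 (d n c : ℝ) (Q μ : ℝ) : ℝ :=
  ∫ q in (1:ℝ)..Q, F1 d n c q μ * q ^ n

def F3 (d n c : ℝ) (Q μ : ℝ) : ℝ :=
  F1 d n c Q μ - n * ∫ q in (1:ℝ)..Q, F2 d n c q μ * q ^ (-(n + 2))

def mu1 (d n c Q : ℝ) : ℝ := -(F1 d n c Q 0) / (F1 d n c Q 1 - F1 d n c Q 0)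
def mu2 (d n c Q : ℝ) : ℝ := -(F2 d n c Q 0) / (F2 d n c Q 1 - F2 d n c Q 0)
def mu3 (d n c Q : ℝ) : ℝ := -(F3 d n c Q 0) / (F3 d n c Q 1 - F3 d n c Q 0)

def h3ex (d n Q : ℝ) : ℝ :=
  d * (1 - n * Real.log Q / (n + 1) - n / (n + 1) ^ 2 * (Q ^ (-(n + 1)) - 1))

def setA (d n c Qs : ℝ) : Set ℝ :=
  {μ : ℝ | μ < 0 ∧ ∃ (Q : ℝ → ℝ) (σ rs : ℝ), 0 < rs ∧ rs < σ ∧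
    isIVPSolutionOn d n c μ Q σ ∧ (∀ r ∈ Ioc (0:ℝ) σ, 0 < Q r ∧ deriv Q r < 0) ∧
    Q rs = Qs}

theorem hasDerivAt_integral_of_continuousOn_Ioi {u : ℝ → ℝ} (hu : ContinuousOn u (Ioi 0))
    {Q : ℝ} (hQ : 0 < Q) : HasDerivAt (fun x => ∫ q in (1:ℝ)..x, u q) (u Q) Q := by
  have hsub : uIcc 1 Q ⊆ Ioi (0:ℝ) := fun x hx => lt_of_lt_of_le (lt_min one_pos hQ) hx.1
  exact intervalIntegral.integral_hasDerivAt_right (hu.mono hsub).intervalIntegrable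
    (hu.stronglyMeasurableAtFilter isOpen_Ioi Q hQ) (hu.continuousAt (Ioi_mem_nhds hQ))

theorem hasDerivAt_F1 {d n c μ Q : ℝ} (hn : 1 < n) (hQ : 0 < Q) :
    HasDerivAt (fun q => F1 d n c q μ) (Q ^ (-n) - n / c / Q) Q := by
  have h := (((((Real.hasDerivAt_rpow_const (p := 1 - n) (Or.inl hQ.ne')).sub_const 1).const_mul
    (-(1 / (n - 1)))).sub ((Real.hasDerivAt_log hQ.ne').const_mul (n / c))).add_const (μ * d))
  refine h.congr_deriv ?_
  have : n - 1 ≠ 0 := by linarith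
  rw [show 1 - n - 1 = -n by ring]
  field_simp
  ring

theorem F1_one {d n c μ : ℝ} : F1 d n c 1 μ = μ * d := by
  simp [F1]

theorem continuousOn_F1_mul {d n c μ : ℝ} (hn : 1 < n) :
    ContinuousOn (fun q => F1 d n c q μ * q ^ n) (Ioi 0) := fun _ hq =>
  ((hasDerivAt_F1 hn hq).continuousAt.mul
    (Real.continuousAt_rpow_const _ _ (Or.inl (ne_of_gt hq)))).continuousWithinAt

theorem hasDerivAt_F2 {d n c μ Q : ℝ} (hn : 1 < n) (hQ : 0 < Q) :
    HasDerivAt (fun q => F2 d n c q μ) (F1 d n c Q μ * Q ^ n) Q :=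
  hasDerivAt_integral_of_continuousOn_Ioi (continuousOn_F1_mul hn) hQ

theorem F2_one {d n c μ : ℝ} : F2 d n c 1 μ = 0 := by
  simp [F2]

theorem hasDerivAt_F3_one {d n c μ : ℝ} (hn : 1 < n) :
    HasDerivAt (fun q => F3 d n c q μ) (1 - n / c) 1 := by
  have hc : ContinuousOn (fun q => F2 d n c q μ * q ^ (-(n + 2))) (Ioi 0) := fun _ hq =>
    ((hasDerivAt_F2 hn hq).continuousAt.mul
      (Real.continuousAt_rpow_const _ _ (Or.inl (ne_of_gt hq)))).continuousWithinAt
  refine ((hasDerivAt_F1 hn one_pos).sub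
    ((hasDerivAt_integral_of_continuousOn_Ioi hc one_pos).const_mul n)).congr_deriv ?_
  simp [F2_one]

theorem F3_one {d n c μ : ℝ} : F3 d n c 1 μ = μ * d := by
  simp [F3, F1_one]

theorem tendsto_div_sub_nhdsLT {g : ℝ → ℝ} {a g' : ℝ} (hg : HasDerivAt g g' a) (ha : g a = 0) :
    Tendsto (fun x => g x / (x - a)) (𝓝[<] a) (𝓝 g') := by
  have h := (hasDerivAt_iff_tendsto_slope.1 hg).mono_left
    (nhdsWithin_mono (s := Iio a) a fun _ hx => (mem_Iio.1 hx).ne)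
  simpa [slope_fun_def_field, ha] using h

theorem eventually_pos_nhdsLT_of_deriv_neg {g : ℝ → ℝ} {a g' : ℝ} (hg : HasDerivAt g g' a)
    (ha : g a = 0) (hneg : g' < 0) : ∀ᶠ x in 𝓝[<] a, 0 < g x := by
  filter_upwards [(tendsto_div_sub_nhdsLT hg ha).eventually_lt_const hneg, self_mem_nhdsWithin]
    with x hx hxa
  have hxa' : x - a < 0 := sub_neg.2 hxa
  by_contra! h
  exact absurd (div_nonneg_of_nonpos h hxa'.le) (not_le.2 hx)

theorem neg_div_tendsto_zero_and_eventually_neg {g h : ℝ → ℝ} {a g' : ℝ} (hg : HasDerivAt g g' a)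
    (ha : g a = 0) (hneg : g' < 0) (hh : ContinuousAt h a) (hpos : 0 < h a) :
    Tendsto (fun x => -g x / h x) (𝓝[<] a) (𝓝 0) ∧ ∀ᶠ x in 𝓝[<] a, -g x / h x < 0 := by
  constructor
  · have h0 : ContinuousAt (fun x => -g x / h x) a := hg.continuousAt.neg.div hh hpos.ne'
    simpa [ha] using h0.tendsto.mono_left (nhdsWithin_le_nhds (s := Iio a))
  · filter_upwards [eventually_pos_nhdsLT_of_deriv_neg hg ha hneg,
      (hh.eventually_const_lt hpos).filter_mono nhdsWithin_le_nhds] with x hx hx'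
    exact div_neg_of_neg_of_pos (neg_neg_of_pos hx) hx'

theorem eventually_F2_zero_neg {d n c : ℝ} (hn : 1 < n) (hnc : 1 - n / c < 0) :
    ∀ᶠ Q in 𝓝[<] (1:ℝ), F2 d n c Q 0 < 0 := by
  have hF : HasDerivAt (fun q => F1 d n c q 0) (1 - n / c) 1 := by
    simpa using hasDerivAt_F1 (d := d) (c := c) (μ := 0) hn one_pos
  have h := eventually_pos_nhdsLT_of_deriv_neg hF (by simp [F1_one]) hnc
  obtain ⟨l, hl, hl'⟩ := (mem_nhdsLT_iff_exists_Ioo_subset).1 h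
  filter_upwards [Ioo_mem_nhdsLT (max_lt (mem_Iio.1 hl) one_pos)] with Q hQ
  have hQ0 : 0 < Q := (le_max_right _ _).trans_lt hQ.1
  have hlQ : l < Q := (le_max_left _ _).trans_lt hQ.1
  rw [F2, intervalIntegral.integral_symm, neg_lt_zero]
  refine intervalIntegral.intervalIntegral_pos_of_pos_on
    ((continuousOn_F1_mul hn).mono ?_).intervalIntegrable (fun x hx => ?_) hQ.2
  · rw [uIcc_of_le hQ.2.le]
    exact fun x hx => hQ0.trans_le hx.1
  · exact mul_pos (hl' ⟨hlQ.trans hx.1, hx.2⟩) (Real.rpow_pos_of_pos (hQ0.trans hx.1) n)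

/-- Each μᵢ tends to 0 from below as Q → 1⁻ (Lemma on μᵢ properties, item (1)). -/
theorem magma_mui_tendsto_zero
    (d n c : ℝ) (hd : 0 < d) (hn : n ∈ Icc (2:ℝ) 3) (hc : c ∈ Ico (1.55:ℝ) n) :
    (Tendsto (mu1 d n c) (𝓝[<] (1:ℝ)) (𝓝 0) ∧ ∀ᶠ Q in 𝓝[<] (1:ℝ), mu1 d n c Q < 0) ∧
    (Tendsto (mu2 d n c) (𝓝[<] (1:ℝ)) (𝓝 0) ∧ ∀ᶠ Q in 𝓝[<] (1:ℝ), mu2 d n c Q < 0) ∧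
    (Tendsto (mu3 d n c) (𝓝[<] (1:ℝ)) (𝓝 0) ∧ ∀ᶠ Q in 𝓝[<] (1:ℝ), mu3 d n c Q < 0) := by
  have hn1 : 1 < n := by linarith [hn.1]
  have hc0 : 0 < c := by linarith [hc.1]
  have hnc : 1 - n / c < 0 := sub_neg.2 ((one_lt_div hc0).2 hc.2)
  have hF1 : ∀ μ, HasDerivAt (fun q => F1 d n c q μ) (1 - n / c) 1 := fun μ => by
    simpa using hasDerivAt_F1 (d := d) (c := c) (μ := μ) hn1 one_pos
  have hF2 : ∀ μ, HasDerivAt (fun q => F2 d n c q μ) (μ * d) 1 := fun μ => by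
    simpa [F1_one] using hasDerivAt_F2 (d := d) (c := c) (μ := μ) hn1 one_pos
  have hF3 : ∀ μ, HasDerivAt (fun q => F3 d n c q μ) (1 - n / c) 1 := fun _ =>
    hasDerivAt_F3_one hn1
  refine ⟨?_, ⟨?_, ?_⟩, ?_⟩
  · exact neg_div_tendsto_zero_and_eventually_neg (hF1 0) (by simp [F1_one]) hnc
      ((hF1 1).continuousAt.sub (hF1 0).continuousAt) (by simpa [F1_one] using hd)
  · have h := (tendsto_div_sub_nhdsLT (hF2 0) F2_one).neg.div
      (tendsto_div_sub_nhdsLT ((hF2 1).sub (hF2 0)) (by simp [F2_one])) (by simpa using hd.ne')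
    rw [zero_mul, neg_zero, zero_div] at h
    refine h.congr' ?_
    filter_upwards [self_mem_nhdsWithin] with Q hQ
    have hQ1 : Q - 1 ≠ 0 := (sub_neg.2 hQ).ne
    simp only [mu2, Pi.div_apply, Pi.sub_apply, ← neg_div]
    exact div_div_div_cancel_right₀ hQ1 _ _
  · filter_upwards [eventually_F2_zero_neg (d := d) hn1 hnc,
      eventually_pos_nhdsLT_of_deriv_neg ((hF2 0).sub (hF2 1)) (by simp [F2_one])
        (by simpa using hd)] with Q hg hh
    exact div_neg_of_pos_of_neg (neg_pos.2 hg) (by simpa using hh)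
  · exact neg_div_tendsto_zero_and_eventually_neg (hF3 0) (by simp [F3_one]) hnc
      ((hF3 1).continuousAt.sub (hF3 0).continuousAt) (by simpa [F3_one] using hd)
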